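/- arXiv:2402.12583 — 4 statements merged into one kernel-verified Lean document; each statement's English description precedes it below -/
import Mathlib

section
/- (Changes-in-changes identification.) CiC setup: groups d ∈ {0,1} and times t ∈ {t₀,t₁}; on a probability space, for each group d there is a latent real random variable U_d, and there are common production functions h(·;t) : ℝ → ℝ (the same for both groups) that are strictly increasing bijections; the untreated potential outcome is Y⁰_d(t) := h(U_d;t), with CDF F_{d,t}. Assume all Y⁰_d(t) take values in a common compact interval [a,b] and each F_{d,t}, restricted to [a,b], is continuous and strictly increasing from [a,b] onto [0,1]. Then for every y ∈ [a,b]: F_{1,t₁}(y) = F_{1,t₀}(F⁻¹_{0,t₀}(F_{0,t₁}(y))), where F⁻¹_{0,t₀}(u) := inf{z ∈ [a,b] : F_{0,t₀}(z) ≥ u}. -/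
open MeasureTheory Set

/- The generalized inverse of `F` on the interval `[a,b]`:
`F⁻¹(u) := inf {y ∈ [a,b] | F y ≥ u}`, defined to be `b` when this set is empty. -/
open Classical in
noncomputable def genInv (F : ℝ → ℝ) (a b u : ℝ) : ℝ :=
  if ({y : ℝ | y ∈ Set.Icc a b ∧ u ≤ F y}).Nonempty then
    sInf {y : ℝ | y ∈ Set.Icc a b ∧ u ≤ F y}
  else b

theorem genInv_apply_of_strictMonoOn {F : ℝ → ℝ} {a b z : ℝ}
    (hF : StrictMonoOn F (Icc a b)) (hz : z ∈ Icc a b) : genInv F a b (F z) = z := by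
  have hleast : IsLeast {y : ℝ | y ∈ Icc a b ∧ F z ≤ F y} z :=
    ⟨⟨hz, le_rfl⟩, fun y hy => (hF.le_iff_le hz hy.1).1 hy.2⟩
  rw [genInv, if_pos hleast.nonempty, hleast.csInf_eq]

theorem StrictMonoOn.apply_left_eq_zero_of_image {F : ℝ → ℝ} {a b : ℝ} (hab : a ≤ b)
    (hF : StrictMonoOn F (Icc a b)) (himg : F '' Icc a b = Icc (0 : ℝ) 1) : F a = 0 := by
  have ha : a ∈ Icc a b := left_mem_Icc.2 hab
  have h0 : (0 : ℝ) ∈ F '' Icc a b := himg ▸ left_mem_Icc.2 zero_le_one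
  obtain ⟨x, hx, hx0⟩ := h0
  have hFa : F a ∈ Icc (0 : ℝ) 1 := himg ▸ mem_image_of_mem F ha
  exact le_antisymm (hx0 ▸ hF.monotoneOn ha hx hx.1) hFa.1

/-- The CDF of a random variable with values in `[a, b]` that vanishes at `a` does not change
when its argument is projected onto `[a, b]`. -/
theorem exists_mem_Icc_forall_cdf_eq {Ω ι : Type*} [MeasurableSpace Ω] (P : Measure Ω)
    {a b : ℝ} (hab : a ≤ b) (X : ι → Ω → ℝ) (hX : ∀ i ω, X i ω ∈ Icc a b)
    (ha : ∀ i, (P {ω | X i ω ≤ a}).toReal = 0) (z : ℝ) :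
    ∃ w ∈ Icc a b, ∀ i, (P {ω | X i ω ≤ z}).toReal = (P {ω | X i ω ≤ w}).toReal := by
  rcases lt_or_ge z a with hza | haz
  · refine ⟨a, left_mem_Icc.2 hab, fun i => ?_⟩
    have hempty : {ω | X i ω ≤ z} = ∅ :=
      eq_empty_of_forall_notMem fun ω hω => (hza.trans_le (hX i ω).1).not_ge hω
    simp [hempty, ha i]
  · rcases le_or_gt z b with hzb | hbz
    · exact ⟨z, ⟨haz, hzb⟩, fun _ => rfl⟩
    · refine ⟨b, right_mem_Icc.2 hab, fun i => ?_⟩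
      have hset : {ω | X i ω ≤ z} = {ω | X i ω ≤ b} := by
        ext ω
        exact iff_of_true ((hX i ω).2.trans hbz.le) (hX i ω).2
      rw [hset]

/-- Changes-in-changes identification: with groups `d ∈ {0,1}` (index `Fin 2`,
`1` the treated group) and times `t ∈ {t₀, t₁}` (index `Fin 2`, `0` for `t₀`), common strictly
increasing bijective production functions `h(·;t)`, untreated potential outcomes
`Y⁰_d(t) = h(U_d; t)` with CDFs `F d t`, all supported in `[a,b]` with CDFs continuous and
strictly increasing from `[a,b]` onto `[0,1]`, one has
`F_{1,t₁}(y) = F_{1,t₀}(F⁻¹_{0,t₀}(F_{0,t₁}(y)))` for all `y ∈ [a,b]`. -/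
theorem cic_identification
    {Ω : Type*} [MeasurableSpace Ω] (P : Measure Ω) [IsProbabilityMeasure P]
    (a b : ℝ) (hab : a ≤ b)
    (U : Fin 2 → Ω → ℝ) (hU : ∀ d, Measurable (U d))
    (h : Fin 2 → ℝ → ℝ)
    (hmono : ∀ t, StrictMono (h t)) (hbij : ∀ t, Function.Bijective (h t))
    (F : Fin 2 → Fin 2 → ℝ → ℝ)
    (hF : ∀ d t y, F d t y = (P {ω | h t (U d ω) ≤ y}).toReal)
    (hsupp : ∀ d t ω, h t (U d ω) ∈ Set.Icc a b)
    (hcont : ∀ d t, ContinuousOn (F d t) (Set.Icc a b))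
    (hstrict : ∀ d t, StrictMonoOn (F d t) (Set.Icc a b))
    (himg : ∀ d t, F d t '' Set.Icc a b = Set.Icc (0 : ℝ) 1)
    (y : ℝ) (hy : y ∈ Set.Icc a b) :
    F 1 1 y = F 1 0 (genInv (F 0 0) a b (F 0 1 y)) := by
  obtain ⟨x, rfl⟩ := (hbij 1).surjective y
  obtain ⟨w, hw, hcdf⟩ := exists_mem_Icc_forall_cdf_eq P hab (fun d ω => h 0 (U d ω))
    (fun d => hsupp d 0)
    (fun d => (hF d 0 a).symm.trans
      ((hstrict d 0).apply_left_eq_zero_of_image hab (himg d 0))) (h 0 x)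
  have key : ∀ d, F d 1 (h 1 x) = F d 0 w := fun d => by
    rw [hF, hF, ← hcdf d]
    simp only [(hmono _).le_iff_le]
  rw [key 1, key 0, genInv_apply_of_strictMonoOn (hstrict 0 0) hw]
end

section
/- (ε-monotonicity sandwich.) Let U be a real-valued random variable on a probability space with CDF G, and let h : ℝ → ℝ be a bijection with inverse h⁻¹. Suppose that for every u ∈ ℝ, P((U − u)·(h(U) − h(u)) < 0) ≤ ε/2. Then for every y ∈ ℝ: G(h⁻¹(y)) − ε/2 ≤ P(h(U) ≤ y) ≤ G(h⁻¹(y)) + ε/2. -/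
open MeasureTheory Set

/-- ε-monotonicity sandwich: if `U` has CDF `G`, `h : ℝ → ℝ` is a bijection
with inverse `hinv`, and for every `u` we have `P((U − u)(h(U) − h(u)) < 0) ≤ ε/2`, then
for every `y`, `G(h⁻¹(y)) − ε/2 ≤ P(h(U) ≤ y) ≤ G(h⁻¹(y)) + ε/2`. -/
theorem eps_monotonicity_sandwich
    {Ω : Type*} [MeasurableSpace Ω] (P : Measure Ω) [IsProbabilityMeasure P]
    (U : Ω → ℝ) (hU : Measurable U)
    (G : ℝ → ℝ) (hG : ∀ u, G u = (P {ω | U ω ≤ u}).toReal)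
    (h hinv : ℝ → ℝ)
    (hli : Function.LeftInverse hinv h) (hri : Function.RightInverse hinv h)
    (ε : ℝ)
    (heps : ∀ u : ℝ, (P {ω | (U ω - u) * (h (U ω) - h u) < 0}).toReal ≤ ε / 2)
    (y : ℝ) :
    G (hinv y) - ε / 2 ≤ (P {ω | h (U ω) ≤ y}).toReal ∧
      (P {ω | h (U ω) ≤ y}).toReal ≤ G (hinv y) + ε / 2 := by
  have key : ∀ s t b : Set Ω, s ⊆ t ∪ b → (P s).toReal ≤ (P t).toReal + (P b).toReal :=
    fun s t b hst => (measureReal_mono (μ := P) hst).trans (measureReal_union_le t b)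
  have hy : h (hinv y) = y := hri y
  have hbad := heps (hinv y)
  rw [hy] at hbad
  rw [hG]
  constructor
  · have := key {ω | U ω ≤ hinv y} {ω | h (U ω) ≤ y}
      {ω | (U ω - hinv y) * (h (U ω) - y) < 0} (by
        intro ω hω
        by_cases hle : h (U ω) ≤ y
        · exact Or.inl hle
        · have hne : U ω ≠ hinv y := fun e => hle (by rw [e, hy])
          have hlt : U ω < hinv y := lt_of_le_of_ne hω hne
          exact Or.inr (mul_neg_of_neg_of_pos (sub_neg.2 hlt) (sub_pos.2 (not_le.1 hle))))
    linarith
  · have := key {ω | h (U ω) ≤ y} {ω | U ω ≤ hinv y}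
      {ω | (U ω - hinv y) * (h (U ω) - y) < 0} (by
        intro ω hω
        by_cases hle : U ω ≤ hinv y
        · exact Or.inl hle
        · have hne : h (U ω) ≠ y := fun e => hle (by rw [← e, hli])
          have hlt : h (U ω) < y := lt_of_le_of_ne hω hne
          exact Or.inr (mul_neg_of_pos_of_neg (sub_pos.2 (not_le.1 hle)) (sub_neg.2 hlt)))
    linarith
end

section
/- (Partial identification for changes-in-changes under ε-monotonicity and δ-invariance.) CiC setup with time-varying latents: groups d ∈ {0,1} and times t ∈ {t₀,t₁}; on a probability space, for each (d,t) there is a latent real random variable U_{d,t} with CDF G_{d,t}, and there are common production functions h(·;t) : ℝ → ℝ (the same for both groups) that are bijections of ℝ; the untreated potential outcome is Y⁰_d(t) := h(U_{d,t};t), with CDF F_{d,t}. Assume: (i) for every u ∈ ℝ and each (d,t), P((U_{d,t} − u)·(h(U_{d,t};t) − h(u;t)) < 0) ≤ ε/2; (ii) for each d, sup_u |G_{d,t₁}(u) − G_{d,t₀}(u)| ≤ δ; (iii) all Y⁰_d(t) take values in a common compact interval [a,b] and each F_{d,t} restricted to [a,b] is continuous and strictly increasing from [a,b] onto [0,1].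 Then for every y ∈ [a,b]: F_{1,t₀}(F⁻¹_{0,t₀}(F_{0,t₁}(y) − ε − δ)) − ε − δ ≤ F_{1,t₁}(y) ≤ F_{1,t₀}(F⁻¹_{0,t₀}(F_{0,t₁}(y) + ε + δ)) + ε + δ, where F⁻¹_{0,t₀}(u) := inf{z ∈ [a,b] : F_{0,t₀}(z) ≥ u} (and := b when this set is empty). -/
open MeasureTheory Set

/-- Any point of `[a,b]` whose value is at least `u` lies to the right of `genInv F a b u`. -/
theorem genInv_le_of_le {F : ℝ → ℝ} {a b u z : ℝ} (hz : z ∈ Set.Icc a b) (hu : u ≤ F z) :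
    genInv F a b u ≤ z := by
  rw [genInv, if_pos ⟨z, hz, hu⟩]
  exact csInf_le ⟨a, fun x hx => hx.1.1⟩ ⟨hz, hu⟩

/-- Any point of `[a,b]` whose value under a strictly increasing `F` is at most `u` lies to the
left of `genInv F a b u`. -/
theorem le_genInv_of_le {F : ℝ → ℝ} {a b u z : ℝ} (hF : StrictMonoOn F (Set.Icc a b))
    (hz : z ∈ Set.Icc a b) (hu : F z ≤ u) : z ≤ genInv F a b u := by
  unfold genInv
  split_ifs with hne
  · exact le_csInf hne fun x hx => (hF.le_iff_le hz hx.1).1 (hu.trans hx.2)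
  · exact hz.2

/-- For injective `g`, the events `g X ≤ g u` and `X ≤ u` differ only where the pair
`(X, u)` is discordant under `g`. No measurability is needed. -/
theorem abs_measure_image_le_sub_measure_le {Ω : Type*} [MeasurableSpace Ω] (P : Measure Ω)
    [IsFiniteMeasure P] (X : Ω → ℝ) {g : ℝ → ℝ} (hg : Function.Injective g) (u : ℝ) :
    |(P {ω | g (X ω) ≤ g u}).toReal - (P {ω | X ω ≤ u}).toReal| ≤
      (P {ω | (X ω - u) * (g (X ω) - g u) < 0}).toReal := by
  have key : ∀ {A B C : Set Ω}, A ⊆ B ∪ C →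
      (P A).toReal ≤ (P B).toReal + (P C).toReal := fun hs =>
    (measureReal_mono hs).trans (measureReal_union_le _ _)
  rw [abs_sub_le_iff]
  constructor
  · rw [sub_le_iff_le_add']
    refine key fun ω hω => or_iff_not_imp_left.2 fun hn => ?_
    have h₁ : u < X ω := not_le.1 hn
    have h₂ : g (X ω) < g u := lt_of_le_of_ne hω fun he => h₁.ne' (hg he)
    exact mul_neg_of_pos_of_neg (sub_pos.2 h₁) (sub_neg.2 h₂)
  · rw [sub_le_iff_le_add']
    refine key fun ω hω => or_iff_not_imp_left.2 fun hn => ?_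
    have h₂ : g u < g (X ω) := not_le.1 hn
    have h₁ : X ω < u := lt_of_le_of_ne hω fun he => h₂.ne' (congrArg g he)
    exact mul_neg_of_neg_of_pos (sub_neg.2 h₁) (sub_pos.2 h₂)

/-- Partial identification for changes-in-changes under ε-monotonicity and
δ-invariance: groups `d` and times `t` indexed by `Fin 2` (`1` the treated group, `0` for
`t₀`).  For each `(d,t)` there is a latent `U d t` with CDF `G d t`; the production
functions `h t : ℝ → ℝ` are common across groups and are bijections (with inverses
`hinv t`) that are ε-monotone with respect to each `U d t`; within each group the
Kolmogorov distance between the latent CDFs at the two times is at most `δ`; outcomes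
`Y⁰_d(t) = h t (U d t)` have CDFs `F d t`, supported in `[a,b]`, continuous and strictly
increasing from `[a,b]` onto `[0,1]`.  Then for every `y ∈ [a,b]`,
`F_{1,t₀}(F⁻¹_{0,t₀}(F_{0,t₁}(y) − ε − δ)) − ε − δ ≤ F_{1,t₁}(y) ≤
 F_{1,t₀}(F⁻¹_{0,t₀}(F_{0,t₁}(y) + ε + δ)) + ε + δ`. -/
theorem cic_partial_identification_eps_delta
    {Ω : Type*} [MeasurableSpace Ω] (P : Measure Ω) [IsProbabilityMeasure P]
    (a b : ℝ) (hab : a ≤ b) (ε δ : ℝ)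
    (U : Fin 2 → Fin 2 → Ω → ℝ) (hU : ∀ d t, Measurable (U d t))
    (G : Fin 2 → Fin 2 → ℝ → ℝ)
    (hG : ∀ d t u, G d t u = (P {ω | U d t ω ≤ u}).toReal)
    (h hinv : Fin 2 → ℝ → ℝ)
    (hli : ∀ t, Function.LeftInverse (hinv t) (h t))
    (hri : ∀ t, Function.RightInverse (hinv t) (h t))
    (heps : ∀ d t, ∀ u : ℝ,
      (P {ω | (U d t ω - u) * (h t (U d t ω) - h t u) < 0}).toReal ≤ ε / 2)
    (hdelta : ∀ d, ∀ u : ℝ, |G d 1 u - G d 0 u| ≤ δ)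
    (F : Fin 2 → Fin 2 → ℝ → ℝ)
    (hF : ∀ d t y, F d t y = (P {ω | h t (U d t ω) ≤ y}).toReal)
    (hsupp : ∀ d t ω, h t (U d t ω) ∈ Set.Icc a b)
    (hcont : ∀ d t, ContinuousOn (F d t) (Set.Icc a b))
    (hstrict : ∀ d t, StrictMonoOn (F d t) (Set.Icc a b))
    (himg : ∀ d t, F d t '' Set.Icc a b = Set.Icc (0 : ℝ) 1)
    (y : ℝ) (hy : y ∈ Set.Icc a b) :
    F 1 0 (genInv (F 0 0) a b (F 0 1 y - ε - δ)) - ε - δ ≤ F 1 1 y ∧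
      F 1 1 y ≤ F 1 0 (genInv (F 0 0) a b (F 0 1 y + ε + δ)) + ε + δ := by
  have hmono : ∀ d t, Monotone (F d t) := fun d t x x' hx => by
    rw [hF, hF]
    exact measureReal_mono fun ω (hω : _ ≤ x) => hω.trans hx
  have hclose : ∀ d t u, |F d t (h t u) - G d t u| ≤ ε / 2 := fun d t u => by
    rw [hF, hG]
    exact (abs_measure_image_le_sub_measure_le P (U d t) (hli t).injective u).trans (heps d t u)
  -- Moving a point to its projection on `[a,b]` does not change any outcome CDF.
  have hproj : ∀ d t z, F d t (max a (min b z)) = F d t z := fun d t z => by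
    obtain ⟨x₀, hx₀, h₀⟩ : (0 : ℝ) ∈ F d t '' Set.Icc a b := by rw [himg]; simp
    obtain ⟨x₁, hx₁, h₁⟩ : (1 : ℝ) ∈ F d t '' Set.Icc a b := by rw [himg]; simp
    have hnonneg : 0 ≤ F d t z := by rw [hF]; exact ENNReal.toReal_nonneg
    have hle : F d t z ≤ 1 := by rw [hF]; exact measureReal_le_one
    rcases le_total z a with hza | hza
    · rw [min_eq_right (hza.trans hab), max_eq_left hza]
      exact le_antisymm ((hmono d t hx₀.1).trans (h₀.le.trans hnonneg)) (hmono d t hza)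
    rcases le_total b z with hzb | hzb
    · rw [min_eq_left hzb, max_eq_right hab]
      exact le_antisymm (hmono d t hzb) (hle.trans (h₁.ge.trans (hmono d t hx₁.2)))
    · rw [min_eq_right hzb, max_eq_right hza]
  obtain ⟨z, hz, hcmp⟩ : ∃ z ∈ Set.Icc a b, ∀ d, |F d 1 y - F d 0 z| ≤ ε + δ := by
    refine ⟨max a (min b (h 0 (hinv 1 y))), ⟨le_max_left _ _, max_le hab (min_le_left _ _)⟩,
      fun d => ?_⟩
    rw [hproj]
    have h₁ := hclose d 1 (hinv 1 y)
    rw [hri 1 y] at h₁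
    have h₀ := hclose d 0 (hinv 1 y)
    have hd := hdelta d (hinv 1 y)
    rw [abs_le] at h₀ h₁ hd ⊢
    constructor <;> linarith
  have hc₀ := abs_le.1 (hcmp 0)
  have hc₁ := abs_le.1 (hcmp 1)
  constructor
  · have := hmono 1 0 (genInv_le_of_le (F := F 0 0) (u := F 0 1 y - ε - δ) hz (by linarith))
    linarith
  · have := hmono 1 0 (le_genInv_of_le (u := F 0 1 y + ε + δ) (hstrict 0 0) hz (by linarith))
    linarith
end

section
/- (Proposition 4, Saks–Yu.) Let K ⊆ ℝⁿ be a convex set and F ⊆ ℝⁿ a finite set, and let T : K → F. Say T is monotone if ⟨T(x) − T(y), x − y⟩ ≥ 0 for all x, y ∈ K, and cyclically monotone if for every m ≥ 1 and every x₀, x₁, …, x_m ∈ K with x_{m+1} := x₀, one has Σ_{i=0}^{m} ⟨T(x_i), x_i − x_{i+1}⟩ ≥ 0. Then T is cyclically monotone if and only if T is monotone. -/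
open scoped RealInnerProductSpace
open Finset

section MonotoneMaps

open Filter Topology

variable {E : Type*} [NormedAddCommGroup E] [InnerProductSpace ℝ E]
  {K F : Set E} {T : E → E}

/-- The left Riemann sum of `T` along the segment from `x` to `y`, with `2 ^ k` equal steps. -/
noncomputable def dyadicSum (T : E → E) : ℕ → E → E → ℝ
  | 0, x, y => ⟪T x, y - x⟫
  | k + 1, x, y => dyadicSum T k x (midpoint ℝ x y) + dyadicSum T k (midpoint ℝ x y) y

/-- The integral of `T` along the segment from `x` to `y`, as the supremum of the left dyadic
Riemann sums (which increase when `T` is monotone). -/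
noncomputable def segmentIntegral (T : E → E) (x y : E) : ℝ := ⨆ k, dyadicSum T k x y

lemma dyadicSum_add_swap (T : E → E) (k : ℕ) (x y : E) :
    dyadicSum T k x y + dyadicSum T k y x = -((1 / 2) ^ k * ⟪T y - T x, y - x⟫) := by
  induction k generalizing x y with
  | zero =>
    simp only [dyadicSum, inner_sub_left, inner_sub_right]
    ring
  | succ k ih =>
    have h₁ := ih x (midpoint ℝ x y)
    have h₂ := ih (midpoint ℝ x y) y
    rw [midpoint_sub_left, inner_smul_right] at h₁
    rw [right_sub_midpoint, inner_smul_right] at h₂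
    simp only [dyadicSum, midpoint_comm (R := ℝ) y x]
    simp only [inner_sub_left, invOf_eq_inv] at h₁ h₂ ⊢
    rw [pow_succ]
    linarith

lemma dyadicSum_le_of_subgradient {s : Set E} (hs : Convex ℝ s) {f : E → ℝ}
    (hf : ∀ x ∈ s, ∀ y ∈ s, ⟪T x, y - x⟫ ≤ f y - f x) (k : ℕ) {x y : E}
    (hx : x ∈ s) (hy : y ∈ s) : dyadicSum T k x y ≤ f y - f x := by
  induction k generalizing x y with
  | zero => exact hf x hx y hy
  | succ k ih =>
    have hm := hs.midpoint_mem hx hy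
    have h₁ := ih hx hm
    have h₂ := ih hm hy
    simp only [dyadicSum]
    linarith

lemma monotone_dyadicSum (hK : Convex ℝ K) (hT : ∀ x ∈ K, ∀ y ∈ K, 0 ≤ ⟪T x - T y, x - y⟫)
    {x y : E} (hx : x ∈ K) (hy : y ∈ K) : Monotone fun k ↦ dyadicSum T k x y := by
  refine monotone_nat_of_le_succ fun k ↦ ?_
  induction k generalizing x y with
  | zero =>
    have h := hT _ (hK.midpoint_mem hx hy) x hx
    have hxy : y - x = (midpoint ℝ x y - x) + (y - midpoint ℝ x y) := by abel
    have hm : y - midpoint ℝ x y = midpoint ℝ x y - x := by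
      rw [right_sub_midpoint, midpoint_sub_left]
    simp only [dyadicSum]
    rw [hxy, inner_add_right, hm]
    rw [inner_sub_left] at h
    linarith
  | succ k ih =>
    have hm := hK.midpoint_mem hx hy
    exact add_le_add (ih hx hm) (ih hm hy)

lemma bddAbove_range_dyadicSum (hK : Convex ℝ K)
    (hT : ∀ x ∈ K, ∀ y ∈ K, 0 ≤ ⟪T x - T y, x - y⟫)
    {x y : E} (hx : x ∈ K) (hy : y ∈ K) :
    BddAbove (Set.range fun k ↦ dyadicSum T k x y) := by
  refine ⟨-dyadicSum T 0 y x, ?_⟩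
  rintro _ ⟨k, rfl⟩
  have h := dyadicSum_add_swap T k x y
  have h₀ : dyadicSum T 0 y x ≤ dyadicSum T k y x := monotone_dyadicSum hK hT hy hx k.zero_le
  have h₁ : 0 ≤ (1 / 2 : ℝ) ^ k * ⟪T y - T x, y - x⟫ := mul_nonneg (by positivity) (hT y hy x hx)
  change dyadicSum T k x y ≤ _
  linarith

lemma tendsto_dyadicSum (hK : Convex ℝ K) (hT : ∀ x ∈ K, ∀ y ∈ K, 0 ≤ ⟪T x - T y, x - y⟫)
    {x y : E} (hx : x ∈ K) (hy : y ∈ K) :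
    Tendsto (fun k ↦ dyadicSum T k x y) atTop (𝓝 (segmentIntegral T x y)) :=
  tendsto_atTop_ciSup (monotone_dyadicSum hK hT hx hy) (bddAbove_range_dyadicSum hK hT hx hy)

lemma inner_le_segmentIntegral (hK : Convex ℝ K)
    (hT : ∀ x ∈ K, ∀ y ∈ K, 0 ≤ ⟪T x - T y, x - y⟫)
    {x y : E} (hx : x ∈ K) (hy : y ∈ K) : ⟪T x, y - x⟫ ≤ segmentIntegral T x y :=
  le_ciSup (bddAbove_range_dyadicSum hK hT hx hy) 0

lemma segmentIntegral_swap (hK : Convex ℝ K) (hT : ∀ x ∈ K, ∀ y ∈ K, 0 ≤ ⟪T x - T y, x - y⟫)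
    {x y : E} (hx : x ∈ K) (hy : y ∈ K) : segmentIntegral T y x = -segmentIntegral T x y := by
  have h := (tendsto_dyadicSum hK hT hx hy).add (tendsto_dyadicSum hK hT hy hx)
  simp only [dyadicSum_add_swap] at h
  have h₀ : Tendsto (fun k : ℕ ↦ -((1 / 2 : ℝ) ^ k * ⟪T y - T x, y - x⟫)) atTop (𝓝 0) := by
    simpa using ((tendsto_pow_atTop_nhds_zero_of_lt_one (r := (1 / 2 : ℝ)) (by norm_num)
      (by norm_num)).mul_const ⟪T y - T x, y - x⟫).neg
  linarith [tendsto_nhds_unique h h₀]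

lemma segmentIntegral_midpoint (hK : Convex ℝ K)
    (hT : ∀ x ∈ K, ∀ y ∈ K, 0 ≤ ⟪T x - T y, x - y⟫) {x y : E} (hx : x ∈ K) (hy : y ∈ K) :
    segmentIntegral T x y =
      segmentIntegral T x (midpoint ℝ x y) + segmentIntegral T (midpoint ℝ x y) y := by
  have hm := hK.midpoint_mem hx hy
  exact tendsto_nhds_unique ((tendsto_dyadicSum hK hT hx hy).comp (tendsto_add_atTop_nat 1))
    ((tendsto_dyadicSum hK hT hx hm).add (tendsto_dyadicSum hK hT hm hy))

lemma segmentIntegral_eq_of_subgradient (hK : Convex ℝ K)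
    (hT : ∀ x ∈ K, ∀ y ∈ K, 0 ≤ ⟪T x - T y, x - y⟫) {s : Set E} (hs : Convex ℝ s) (hsK : s ⊆ K)
    {f : E → ℝ} (hf : ∀ x ∈ s, ∀ y ∈ s, ⟪T x, y - x⟫ ≤ f y - f x) {x y : E}
    (hx : x ∈ s) (hy : y ∈ s) : segmentIntegral T x y = f y - f x := by
  have h₁ : segmentIntegral T x y ≤ f y - f x :=
    ciSup_le fun k ↦ dyadicSum_le_of_subgradient hs hf k hx hy
  have h₂ : segmentIntegral T y x ≤ f x - f y :=
    ciSup_le fun k ↦ dyadicSum_le_of_subgradient hs hf k hy hx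
  linarith [segmentIntegral_swap hK hT (hsK hx) (hsK hy)]

/-- Near `p`, a monotone map `T` with finitely many values is a subgradient of
`y ↦ ⟪T y, y - p⟫`, the maximum of `⟪b, y - p⟫` over the values `b` taken arbitrarily close
to `p`. -/
lemma exists_ball_inner_le (hF : F.Finite) (hTF : ∀ x ∈ K, T x ∈ F)
    (hT : ∀ x ∈ K, ∀ y ∈ K, 0 ≤ ⟪T x - T y, x - y⟫) (p : E) :
    ∃ r > 0, ∀ x ∈ K ∩ Metric.ball p r, ∀ y ∈ K ∩ Metric.ball p r,
      ⟪T x, y - x⟫ ≤ ⟪T y, y - p⟫ - ⟪T x, x - p⟫ := by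
  have hev : ∀ᶠ x in 𝓝 p, ∀ a ∈ F, x ∈ K ∩ T ⁻¹' {a} → p ∈ closure (K ∩ T ⁻¹' {a}) := by
    refine (eventually_all_finite hF).2 fun a _ ↦ ?_
    by_cases hp : p ∈ closure (K ∩ T ⁻¹' {a})
    · exact Eventually.of_forall fun _ _ ↦ hp
    · filter_upwards [isClosed_closure.isOpen_compl.mem_nhds hp] with x hx hxa
      exact absurd (subset_closure hxa) hx
  obtain ⟨r, hr, hball⟩ := Metric.eventually_nhds_iff_ball.1 hev
  refine ⟨r, hr, fun x hx y hy ↦ ?_⟩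
  have hp : p ∈ closure (K ∩ T ⁻¹' {T x}) := hball x hx.2 (T x) (hTF x hx.1) ⟨hx.1, rfl⟩
  have hclosed : IsClosed {u : E | 0 ≤ ⟪T y - T x, y - u⟫} :=
    isClosed_le continuous_const (by fun_prop)
  have h : 0 ≤ ⟪T y - T x, y - p⟫ := by
    refine closure_minimal (fun u hu ↦ ?_) hclosed hp
    have h := hT y hy.1 u hu.1
    rwa [show T u = T x from hu.2] at h
  simp only [inner_sub_left, inner_sub_right] at h ⊢
  linarith

lemma segmentIntegral_triangle (hK : Convex ℝ K) (hF : F.Finite) (hTF : ∀ x ∈ K, T x ∈ F)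
    (hT : ∀ x ∈ K, ∀ y ∈ K, 0 ≤ ⟪T x - T y, x - y⟫)
    {x y z : E} (hx : x ∈ K) (hy : y ∈ K) (hz : z ∈ K) :
    segmentIntegral T x y + segmentIntegral T y z + segmentIntegral T z x = 0 := by
  choose r hr hloc using exists_ball_inner_le hF hTF hT
  set H := convexHull ℝ ({x, y, z} : Set E)
  have hHK : H ⊆ K := convexHull_min (by simp [Set.insert_subset_iff, hx, hy, hz]) hK
  have hH : Convex ℝ H := convex_convexHull ℝ _
  have hHc : IsCompact H := (Set.toFinite {x, y, z}).isCompact_convexHull ℝ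
  obtain ⟨ε, hε, hLeb⟩ := lebesgue_number_lemma_of_metric (c := fun p ↦ Metric.ball p (r p)) hHc
    (fun _ ↦ Metric.isOpen_ball) fun p _ ↦ Set.mem_iUnion.2 ⟨p, Metric.mem_ball_self (hr p)⟩
  have key : ∀ k : ℕ, ∀ a ∈ H, ∀ b ∈ H, ∀ c ∈ H, dist a b < 2 ^ k * ε → dist b c < 2 ^ k * ε →
      dist c a < 2 ^ k * ε →
      segmentIntegral T a b + segmentIntegral T b c + segmentIntegral T c a = 0 := by
    intro k
    induction k with
    | zero =>
      intro a ha b hb c hc hab _ hca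
      rw [pow_zero, one_mul] at hab hca
      obtain ⟨p, hp⟩ := hLeb a ha
      have hs : Convex ℝ (K ∩ Metric.ball p (r p)) := hK.inter (convex_ball p (r p))
      have ha' : a ∈ K ∩ Metric.ball p (r p) := ⟨hHK ha, hp (Metric.mem_ball_self hε)⟩
      have hb' : b ∈ K ∩ Metric.ball p (r p) := ⟨hHK hb, hp (Metric.mem_ball'.2 hab)⟩
      have hc' : c ∈ K ∩ Metric.ball p (r p) := ⟨hHK hc, hp (Metric.mem_ball.2 hca)⟩
      have heq := fun {u v : E} ↦ segmentIntegral_eq_of_subgradient (x := u) (y := v) hK hT hs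
        Set.inter_subset_left (f := fun y ↦ ⟪T y, y - p⟫) (hloc p)
      rw [heq ha' hb', heq hb' hc', heq hc' ha']
      ring
    | succ k ih =>
      intro a ha b hb c hc hab hbc hca
      rw [pow_succ] at hab hbc hca
      have hmab := hH.midpoint_mem ha hb
      have hmbc := hH.midpoint_mem hb hc
      have hmca := hH.midpoint_mem hc ha
      have hcorner : ∀ {u v w : E}, dist v w < 2 ^ k * 2 * ε → dist u v < 2 ^ k * 2 * ε →
          dist w u < 2 ^ k * 2 * ε → dist u (midpoint ℝ u v) < 2 ^ k * ε ∧
          dist (midpoint ℝ u v) (midpoint ℝ w u) < 2 ^ k * ε ∧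
          dist (midpoint ℝ w u) u < 2 ^ k * ε := fun {u v w} hvw huv hwu ↦ by
        have h := dist_midpoint_midpoint_le v u w u
        rw [midpoint_comm (R := ℝ) v u, dist_self] at h
        rw [dist_left_midpoint, dist_midpoint_right, Real.norm_ofNat]
        refine ⟨by linarith, by linarith, by linarith⟩
      obtain ⟨ha₁, ha₂, ha₃⟩ := hcorner hbc hab hca
      obtain ⟨hb₁, hb₂, hb₃⟩ := hcorner hca hbc hab
      obtain ⟨hc₁, hc₂, hc₃⟩ := hcorner hab hca hbc
      have hA := ih a ha _ hmab _ hmca ha₁ ha₂ ha₃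
      have hB := ih b hb _ hmbc _ hmab hb₁ hb₂ hb₃
      have hC := ih c hc _ hmca _ hmbc hc₁ hc₂ hc₃
      have hM := ih _ hmab _ hmbc _ hmca (by rwa [dist_comm]) (by rwa [dist_comm])
        (by rwa [dist_comm])
      have hswap := fun {u v : E} (hu : u ∈ H) (hv : v ∈ H) ↦
        segmentIntegral_swap hK hT (hHK hu) (hHK hv)
      rw [segmentIntegral_midpoint hK hT (hHK ha) (hHK hb),
        segmentIntegral_midpoint hK hT (hHK hb) (hHK hc),
        segmentIntegral_midpoint hK hT (hHK hc) (hHK ha)]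
      linarith [hswap hmab hmbc, hswap hmbc hmca, hswap hmca hmab]
  obtain ⟨k, hk⟩ := pow_unbounded_of_one_lt ((dist x y + dist y z + dist z x) / ε) one_lt_two
  rw [div_lt_iff₀ hε] at hk
  have hsub : ({x, y, z} : Set E) ⊆ H := subset_convexHull ℝ _
  refine key k x (hsub (by simp)) y (hsub (by simp)) z (hsub (by simp)) ?_ ?_ ?_ <;>
    linarith [dist_nonneg (x := x) (y := y), dist_nonneg (x := y) (y := z),
      dist_nonneg (x := z) (y := x)]

end MonotoneMaps

/-- Proposition 4, Saks–Yu: let `K ⊆ ℝⁿ` be convex, `F ⊆ ℝⁿ` finite, and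
`T` a map sending `K` into `F`.  Then `T` is cyclically monotone on `K` (for every `m ≥ 1`
and cycle `x₀, …, x_m, x_{m+1} = x₀` in `K`, `∑ᵢ ⟪T xᵢ, xᵢ − xᵢ₊₁⟫ ≥ 0`) if and only if
`T` is monotone on `K` (`⟪T x − T y, x − y⟫ ≥ 0` for all `x, y ∈ K`). -/
theorem saks_yu_cyclically_monotone_iff_monotone
    {n : ℕ} (K F : Set (EuclideanSpace ℝ (Fin n)))
    (hK : Convex ℝ K) (hF : F.Finite)
    (T : EuclideanSpace ℝ (Fin n) → EuclideanSpace ℝ (Fin n))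
    (hT : ∀ x ∈ K, T x ∈ F) :
    (∀ m : ℕ, 1 ≤ m → ∀ x : Fin (m + 1) → EuclideanSpace ℝ (Fin n),
        (∀ i, x i ∈ K) → 0 ≤ ∑ i : Fin (m + 1), ⟪T (x i), x i - x (i + 1)⟫) ↔
      (∀ x ∈ K, ∀ y ∈ K, 0 ≤ ⟪T x - T y, x - y⟫) := by
  constructor
  · intro h x hx y hy
    have h₂ := h 1 le_rfl ![x, y] (Fin.forall_fin_two.2 ⟨hx, hy⟩)
    rw [Fin.sum_univ_two] at h₂
    change 0 ≤ ⟪T x, x - y⟫ + ⟪T y, y - x⟫ at h₂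
    rw [← neg_sub x y, inner_neg_right] at h₂
    rw [inner_sub_left]
    linarith
  · intro h m _ x hx
    have hterm : ∀ i, segmentIntegral T (x 0) (x i) - segmentIntegral T (x 0) (x (i + 1)) ≤
        ⟪T (x i), x i - x (i + 1)⟫ := fun i ↦ by
      have h₁ := inner_le_segmentIntegral hK h (hx i) (hx (i + 1))
      have h₂ := segmentIntegral_triangle hK hF hT h (hx 0) (hx i) (hx (i + 1))
      have h₃ := segmentIntegral_swap hK h (hx 0) (hx (i + 1))
      rw [← neg_sub (x i), inner_neg_right] at h₁
      linarith
    refine le_trans (le_of_eq ?_) (Finset.sum_le_sum fun i _ ↦ hterm i)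
    rw [Finset.sum_sub_distrib, eq_comm, sub_eq_zero]
    exact (Equiv.sum_comp (Equiv.addRight 1) fun i ↦ segmentIntegral T (x 0) (x i)).symm
end
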